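/- Correctness of the repair-existence test underlying the consistent-query-answering algorithm (core of Theorem 3 of the paper): Assume the acyclicity assumption. For every instance I and all facts p₁,…,pₙ and s₁,…,s_m, there exists a repair I' of I with {p₁,…,pₙ} ⊆ I' and {s₁,…,s_m} ∩ I' = ∅ if and only if there exist supports Sᵢ ∈ Supp(pᵢ) for i = 1,…,n and blocks (Bⱼ,Nⱼ) ∈ Block(sⱼ) for j = 1,…,m such that, setting P = S₁ ∪ … ∪ Sₙ ∪ B₁ ∪ … ∪ B_m and N = N₁ ∪ … ∪ N_m, the instance T*(P) is consistent and T*(P) ∩ N = ∅. -/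

import Mathlib

/-!
Setting: facts form a type `F` with decidable equality, instances are finite sets of facts.
`T` is a finite set of ground full TGD rules (body, head) with nonempty bodies,
`D` a finite set of ground denial rules (nonempty sets of facts).
Acyclicity: each fact carries a relation name `rel` and there is a rank `rk` on relation
names such that bodies of TGD rules use only relation names of strictly smaller rank
than the head.
-/

variable {F : Type*} [DecidableEq F]

/-- An instance `J` is consistent: every TGD rule whose body is contained in `J`
has its head in `J`, and no denial rule is a subset of `J`. -/
def DBConsistent (T : Finset (Finset F × F)) (D : Finset (Finset F)) (J : Finset F) : Prop :=
  (∀ r ∈ T, r.1 ⊆ J → r.2 ∈ J) ∧ ∀ d ∈ D, ¬ d ⊆ J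

/-- Symmetric difference `Δ(I,J) = (I∖J) ∪ (J∖I)` of two instances. -/
def DBDelta (I J : Finset F) : Finset F := (I \ J) ∪ (J \ I)

/-- `I'` is a repair of `I`: a consistent instance such that no consistent instance `J`
satisfies `Δ(I,J) ⊊ Δ(I,I')`. -/
def DBRepair (T : Finset (Finset F × F)) (D : Finset (Finset F)) (I I' : Finset F) : Prop :=
  DBConsistent T D I' ∧ ¬ ∃ J : Finset F, DBConsistent T D J ∧ DBDelta I J ⊂ DBDelta I I'

/-- `Supp T I p S`: `S` is a support of the fact `p` relative to the instance `I`.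
(S0) if `p ∈ I` then `{p}` is a support of `p`;
(S1) if `p ∉ I`, `(S,p)` is a TGD rule, and each `q ∈ S` has a support `f q`,
then the union of the `f q` is a support of `p`. -/
inductive Supp (T : Finset (Finset F × F)) (I : Finset F) : F → Finset F → Prop
  | base {p : F} (hp : p ∈ I) : Supp T I p {p}
  | step {p : F} {S : Finset F} (f : F → Finset F)
      (hp : p ∉ I) (hS : (S, p) ∈ T) (hf : ∀ q ∈ S, Supp T I q (f q)) :
      Supp T I p (S.biUnion f)


/-- `Block T D I p B N`: `(B,N)` is a block of the fact `p` relative to the instance `I`.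
(B0) if `p ∉ I` then `(∅,{p})` is a block of `p`;
(B1) if `p ∈ I`, `d` is a denial rule containing `p`, and every `q ∈ d∖{p}` has a
support `f q`, then `(⋃ f q, ∅)` is a block of `p`;
(B2) if `p ∈ I`, `(S,q)` is a TGD rule with `p ∈ S`, every `q' ∈ S∖{p}` has a support
`f q'`, and `(B,N)` is a block of `q`, then `(⋃ f q' ∪ B, N)` is a block of `p`. -/
inductive Block (T : Finset (Finset F × F)) (D : Finset (Finset F)) (I : Finset F) :
    F → Finset F → Finset F → Prop
  | neg {p : F} (hp : p ∉ I) : Block T D I p ∅ {p}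
  | denial {p : F} {d : Finset F} (f : F → Finset F)
      (hp : p ∈ I) (hd : d ∈ D) (hpd : p ∈ d)
      (hf : ∀ q ∈ d.erase p, Supp T I q (f q)) :
      Block T D I p ((d.erase p).biUnion f) ∅
  | tgd {p : F} {S : Finset F} {q : F} {B N : Finset F} (f : F → Finset F)
      (hp : p ∈ I) (hS : (S, q) ∈ T) (hpS : p ∈ S)
      (hf : ∀ q' ∈ S.erase p, Supp T I q' (f q'))
      (hB : Block T D I q B N) :
      Block T D I p ((S.erase p).biUnion f ∪ B) N

/-- A set of facts is closed under the TGD rules of `T`. -/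
def DBClosedSet (T : Finset (Finset F × F)) (K : Set F) : Prop :=
  ∀ r ∈ T, (↑r.1 : Set F) ⊆ K → r.2 ∈ K

/-- `T*(J)`: the smallest superset of `J` that contains the head of every TGD rule of `T`
whose body it contains. -/
def DBClosure (T : Finset (Finset F × F)) (J : Finset F) : Set F :=
  ⋂₀ {K : Set F | (↑J : Set F) ⊆ K ∧ DBClosedSet T K}

/-- Consistency for an arbitrary set of facts. -/
def DBConsistentSet (T : Finset (Finset F × F)) (D : Finset (Finset F)) (K : Set F) : Prop :=
  DBClosedSet T K ∧ ∀ d ∈ D, ¬ (↑d : Set F) ⊆ K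

theorem DBClosure_subset {T : Finset (Finset F × F)} {J : Finset F} {K : Set F}
    (hJ : (↑J : Set F) ⊆ K) (hK : DBClosedSet T K) : DBClosure T J ⊆ K :=
  Set.sInter_subset_of_mem ⟨hJ, hK⟩

theorem subset_DBClosure (T : Finset (Finset F × F)) (J : Finset F) :
    (↑J : Set F) ⊆ DBClosure T J :=
  Set.subset_sInter fun _ hK => hK.1

theorem DBClosedSet_DBClosure (T : Finset (Finset F × F)) (J : Finset F) :
    DBClosedSet T (DBClosure T J) := fun r hr hrJ =>
  Set.mem_sInter.2 fun _ hK => hK.2 r hr (hrJ.trans (Set.sInter_subset_of_mem hK))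

theorem finite_DBClosure (T : Finset (Finset F × F)) (J : Finset F) :
    (DBClosure T J).Finite := by
  refine (J ∪ T.image Prod.snd).finite_toSet.subset (DBClosure_subset ?_ ?_)
  · exact Finset.coe_subset.2 Finset.subset_union_left
  · intro r hr _
    exact Finset.mem_union_right _ (Finset.mem_image_of_mem _ hr)

theorem DBConsistentSet_coe {T : Finset (Finset F × F)} {D : Finset (Finset F)} {J : Finset F} :
    DBConsistentSet T D (↑J : Set F) ↔ DBConsistent T D J := by
  simp [DBConsistentSet, DBConsistent, DBClosedSet]

theorem DBConsistent.closedSet {T : Finset (Finset F × F)} {D : Finset (Finset F)}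
    {J : Finset F} (h : DBConsistent T D J) : DBClosedSet T (↑J : Set F) :=
  (DBConsistentSet_coe.2 h).1

theorem DBConsistent.closure {T : Finset (Finset F × F)} {D : Finset (Finset F)}
    {P J : Finset F} (h : DBConsistent T D J) (hP : P ⊆ J) :
    DBConsistentSet T D (DBClosure T P) :=
  ⟨DBClosedSet_DBClosure T P, fun d hd hdP => h.2 d hd <| Finset.coe_subset.1 <|
    hdP.trans (DBClosure_subset (Finset.coe_subset.2 hP) h.closedSet)⟩

theorem exists_DBRepair_DBDelta_subset {T : Finset (Finset F × F)} {D : Finset (Finset F)}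
    (I : Finset F) {J : Finset F} (hJ : DBConsistent T D J) :
    ∃ I', DBRepair T D I I' ∧ DBDelta I I' ⊆ DBDelta I J := by
  obtain ⟨I', ⟨hI', hsub⟩, hmin⟩ :=
    (InvImage.wf (DBDelta I) (wellFounded_lt (α := Finset F))).has_min
      {K | DBConsistent T D K ∧ DBDelta I K ⊆ DBDelta I J} ⟨J, hJ, subset_rfl⟩
  exact ⟨I', ⟨hI', fun ⟨K, hK, hlt⟩ => hmin K ⟨hK, hlt.subset.trans hsub⟩ hlt⟩, hsub⟩

theorem Supp.subset {T : Finset (Finset F × F)} {I S : Finset F} {p : F}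
    (h : Supp T I p S) : S ⊆ I := by
  induction h with
  | base hp => simpa using hp
  | step f _ _ _ ih => exact Finset.biUnion_subset.2 ih

theorem Block.subset {T : Finset (Finset F × F)} {D : Finset (Finset F)} {I B N : Finset F}
    {p : F} (h : Block T D I p B N) : B ⊆ I := by
  induction h with
  | neg _ => exact Finset.empty_subset _
  | denial f _ _ _ hf => exact Finset.biUnion_subset.2 fun q hq => (hf q hq).subset
  | tgd f _ _ _ hf _ ih =>
    exact Finset.union_subset (Finset.biUnion_subset.2 fun q hq => (hf q hq).subset) ih

theorem Block.disjoint {T : Finset (Finset F × F)} {D : Finset (Finset F)} {I B N : Finset F}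
    {p : F} (h : Block T D I p B N) : Disjoint N I := by
  induction h with
  | neg hp => simpa using hp
  | denial f _ _ _ _ => exact Finset.disjoint_empty_left _
  | tgd f _ _ _ _ _ ih => exact ih

theorem Supp.mem {T : Finset (Finset F × F)} {D : Finset (Finset F)} {I J S : Finset F} {p : F}
    (hJ : DBConsistent T D J) (h : Supp T I p S) (hS : S ⊆ J) : p ∈ J := by
  induction h with
  | base _ => simpa using hS
  | step f _ hT _ ih =>
    rw [Finset.biUnion_subset] at hS
    exact hJ.1 _ hT fun q hq => ih q hq (hS q hq)

theorem Block.notMem {T : Finset (Finset F × F)} {D : Finset (Finset F)} {I J B N : Finset F}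
    {p : F} (hJ : DBConsistent T D J) (h : Block T D I p B N) (hB : B ⊆ J)
    (hN : Disjoint N J) : p ∉ J := by
  induction h with
  | neg _ => simpa using hN
  | denial f _ hd hpd hf =>
    intro hp
    rw [Finset.biUnion_subset] at hB
    refine hJ.2 _ hd ?_
    rw [← Finset.insert_erase hpd]
    exact Finset.insert_subset hp fun q hq => (hf q hq).mem hJ (hB q hq)
  | tgd f _ hS hpS hf _ ih =>
    intro hp
    rw [Finset.union_subset_iff, Finset.biUnion_subset] at hB
    refine ih hB.2 hN (hJ.1 _ hS ?_)
    rw [← Finset.insert_erase hpS]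
    exact Finset.insert_subset hp fun q hq => (hf q hq).mem hJ (hB.1 q hq)

theorem DBRepair.subset_DBClosure {T : Finset (Finset F × F)} {D : Finset (Finset F)}
    {I I' : Finset F} (h : DBRepair T D I I') :
    (↑I' : Set F) ⊆ DBClosure T (I ∩ I') := by
  obtain ⟨J, hJ⟩ := (finite_DBClosure T (I ∩ I')).exists_finset_coe
  have hJc : DBConsistent T D J := by
    rw [← DBConsistentSet_coe, hJ]
    exact h.1.closure Finset.inter_subset_right
  have hJI' : J ⊆ I' := by
    rw [← Finset.coe_subset, hJ]
    exact DBClosure_subset (Finset.coe_subset.2 Finset.inter_subset_right) h.1.closedSet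
  have hIJ : I ∩ I' ⊆ J := by
    rw [← Finset.coe_subset, hJ]
    exact _root_.subset_DBClosure T _
  rw [← hJ]
  intro x hx
  by_contra hxJ
  simp only [Finset.mem_coe] at hx hxJ
  have hxI : x ∉ I := fun hxI => hxJ (hIJ (Finset.mem_inter.2 ⟨hxI, hx⟩))
  refine h.2 ⟨J, hJc, Finset.ssubset_iff_exists_cons_subset.2
    ⟨x, by simp [DBDelta, hxI, hxJ], fun y hy => ?_⟩⟩
  have h1 := @hIJ y
  have h2 := @hJI' y
  simp only [Finset.mem_cons, DBDelta, Finset.mem_union, Finset.mem_sdiff, Finset.mem_inter]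
    at hy h1 ⊢
  rcases hy with rfl | hy
  · exact Or.inr ⟨hx, hxI⟩
  · tauto

theorem DBRepair.exists_supp {T : Finset (Finset F × F)} {D : Finset (Finset F)}
    {I I' : Finset F} (h : DBRepair T D I I') {p : F} (hp : p ∈ I') :
    ∃ S, Supp T I p S ∧ S ⊆ I' := by
  suffices hK : DBClosure T (I ∩ I') ⊆ {q | q ∈ I' ∧ ∃ S, Supp T I q S ∧ S ⊆ I'} from
    (hK (h.subset_DBClosure hp)).2
  refine DBClosure_subset (fun q hq => ?_) fun r hr hrK => ?_
  · rw [Finset.mem_coe, Finset.mem_inter] at hq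
    exact ⟨hq.2, {q}, .base hq.1, Finset.singleton_subset_iff.2 hq.2⟩
  · have hrI' : r.2 ∈ I' := h.1.1 r hr fun q hq => (hrK hq).1
    refine ⟨hrI', ?_⟩
    by_cases hrI : r.2 ∈ I
    · exact ⟨{r.2}, .base hrI, Finset.singleton_subset_iff.2 hrI'⟩
    · have hf : ∀ q, ∃ S, q ∈ r.1 → Supp T I q S ∧ S ⊆ I' := fun q => by
        by_cases hq : q ∈ r.1
        · exact (hrK hq).2.imp fun S hS _ => hS
        · exact ⟨∅, fun hq' => absurd hq' hq⟩
      choose f hf using hf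
      exact ⟨r.1.biUnion f, .step f hrI hr fun q hq => (hf q hq).1,
        Finset.biUnion_subset.2 fun q hq => (hf q hq).2⟩

theorem DBRepair.not_DBConsistent_insert {T : Finset (Finset F × F)} {D : Finset (Finset F)}
    {I I' : Finset F} (h : DBRepair T D I I') {s : F} (hsI : s ∈ I) (hs : s ∉ I') :
    ¬ DBConsistent T D (insert s I') := fun hc => by
  refine h.2 ⟨_, hc, Finset.ssubset_iff_exists_cons_subset.2
    ⟨s, by simp [DBDelta, hsI], fun y hy => ?_⟩⟩
  simp only [Finset.mem_cons, DBDelta, Finset.mem_union, Finset.mem_sdiff, Finset.mem_insert]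
    at hy ⊢
  by_cases hys : y = s
  · subst hys
    exact Or.inl ⟨hsI, hs⟩
  · tauto

theorem DBRepair.exists_block {T : Finset (Finset F × F)} {D : Finset (Finset F)}
    (rank : F → ℕ) (hrank : ∀ r ∈ T, ∀ q ∈ r.1, rank q < rank r.2)
    {I I' : Finset F} (h : DBRepair T D I I') {s : F} (hs : s ∉ I') :
    ∃ B N, Block T D I s B N ∧ B ⊆ I' ∧ Disjoint N I' := by
  have hsupp : ∀ q, ∃ S, q ∈ I' → Supp T I q S ∧ S ⊆ I' := fun q => by
    by_cases hq : q ∈ I'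
    · exact (h.exists_supp hq).imp fun S hS _ => hS
    · exact ⟨∅, fun hq' => absurd hq' hq⟩
  choose f hf using hsupp
  induction hk : T.sup (fun r => rank r.2) - rank s using Nat.strong_induction_on
    generalizing s with
  | _ k ih =>
    by_cases hsI : s ∈ I
    swap
    · exact ⟨∅, {s}, .neg hsI, Finset.empty_subset _, Finset.disjoint_singleton_left.2 hs⟩
    have hmem : ∀ S : Finset F, S ⊆ insert s I' → ∀ q ∈ S.erase s, q ∈ I' := fun S hS q hq =>
      Finset.mem_of_mem_insert_of_ne (hS (Finset.mem_of_mem_erase hq)) (Finset.ne_of_mem_erase hq)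
    have hc := h.not_DBConsistent_insert hsI hs
    simp only [DBConsistent, not_and_or, not_forall, not_not, exists_prop] at hc
    obtain ⟨r, hr, hrs, hrn⟩ | ⟨d, hd, hds⟩ := hc
    · have hrI' : r.2 ∉ I' := fun hr' => hrn (Finset.mem_insert_of_mem hr')
      have hsr : s ∈ r.1 := by
        by_contra hsr
        exact hrI' (h.1.1 r hr ((Finset.subset_insert_iff_of_notMem hsr).1 hrs))
      have hlt := hrank r hr s hsr
      have hle : rank r.2 ≤ T.sup (fun r => rank r.2) :=
        Finset.le_sup (f := fun r : Finset F × F => rank r.2) hr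
      obtain ⟨B, N, hBN, hB, hN⟩ := ih _ (by omega) hrI' rfl
      have hq := fun q hq => hf q (hmem r.1 hrs q hq)
      exact ⟨_, N, .tgd f hsI hr hsr (fun q hq' => (hq q hq').1) hBN,
        Finset.union_subset (Finset.biUnion_subset.2 fun q hq' => (hq q hq').2) hB, hN⟩
    · have hsd : s ∈ d := by
        by_contra hsd
        exact h.1.2 d hd ((Finset.subset_insert_iff_of_notMem hsd).1 hds)
      have hq := fun q hq => hf q (hmem d hds q hq)
      exact ⟨_, ∅, .denial f hsI hd hsd (fun q hq' => (hq q hq').1),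
        Finset.biUnion_subset.2 fun q hq' => (hq q hq').2, Finset.disjoint_empty_left _⟩

/-- Core of Theorem 3: under the acyclicity assumption, there is a repair `I'` of `I`
containing all the facts `p i` and none of the facts `s j` iff there are supports
`S i ∈ Supp(p i)` and blocks `(B j, N j) ∈ Block(s j)` such that, with
`P = ⋃ S i ∪ ⋃ B j` and `N = ⋃ N j`, the instance `T*(P)` is consistent and
`T*(P) ∩ N = ∅`. -/
theorem repair_existence_test {R : Type*} (rel : F → R) (rk : R → ℕ)
    (T : Finset (Finset F × F)) (D : Finset (Finset F))
    (hT : ∀ r ∈ T, r.1.Nonempty) (hD : ∀ d ∈ D, d.Nonempty)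
    (hacyc : ∀ r ∈ T, ∀ q ∈ r.1, rk (rel q) < rk (rel r.2))
    (I : Finset F) (n m : ℕ) (p : Fin n → F) (s : Fin m → F) :
    (∃ I' : Finset F, DBRepair T D I I' ∧ (∀ i, p i ∈ I') ∧ ∀ j, s j ∉ I') ↔
      (∃ (S : Fin n → Finset F) (B N : Fin m → Finset F),
        (∀ i, Supp T I (p i) (S i)) ∧
        (∀ j, Block T D I (s j) (B j) (N j)) ∧
        DBConsistentSet T D
          (DBClosure T (Finset.univ.biUnion S ∪ Finset.univ.biUnion B)) ∧
        DBClosure T (Finset.univ.biUnion S ∪ Finset.univ.biUnion B) ∩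
            (↑(Finset.univ.biUnion N) : Set F) = ∅) := by
  constructor
  · rintro ⟨I', hI', hp, hs⟩
    choose S hS hSI' using fun i => hI'.exists_supp (hp i)
    choose B N hBN hB hN using fun j => hI'.exists_block (fun q => rk (rel q)) hacyc (hs j)
    have hP : Finset.univ.biUnion S ∪ Finset.univ.biUnion B ⊆ I' :=
      Finset.union_subset (Finset.biUnion_subset.2 fun i _ => hSI' i)
        (Finset.biUnion_subset.2 fun j _ => hB j)
    refine ⟨S, B, N, hS, hBN, hI'.1.closure hP, ?_⟩
    have hN' : Disjoint (Finset.univ.biUnion N) I' :=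
      (Finset.disjoint_biUnion_left _ _ _).2 fun j _ => hN j
    exact ((Finset.disjoint_coe.2 hN'.symm).mono_left
      (DBClosure_subset (Finset.coe_subset.2 hP) hI'.1.closedSet)).inter_eq
  · rintro ⟨S, B, N, hS, hBN, hcons, hdisj⟩
    have hPI : Finset.univ.biUnion S ∪ Finset.univ.biUnion B ⊆ I :=
      Finset.union_subset (Finset.biUnion_subset.2 fun i _ => (hS i).subset)
        (Finset.biUnion_subset.2 fun j _ => (hBN j).subset)
    have hPJ := subset_DBClosure T (Finset.univ.biUnion S ∪ Finset.univ.biUnion B)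
    obtain ⟨J, hJ⟩ :=
      (finite_DBClosure T (Finset.univ.biUnion S ∪ Finset.univ.biUnion B)).exists_finset_coe
    rw [← hJ] at hcons hdisj hPJ
    obtain ⟨I', hI', hsub⟩ := exists_DBRepair_DBDelta_subset I (DBConsistentSet_coe.1 hcons)
    have hPI' : Finset.univ.biUnion S ∪ Finset.univ.biUnion B ⊆ I' := fun x hx => by
      have hxI := hPI hx
      have hxJ : x ∈ J := hPJ hx
      by_contra hxI'
      have := @hsub x
      simp [DBDelta, hxI, hxJ, hxI'] at this
    have hNI' : ∀ j, Disjoint (N j) I' := fun j => Finset.disjoint_left.2 fun x hx hxI' => by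
      have hxI : x ∉ I := Finset.disjoint_left.1 (hBN j).disjoint hx
      have hxJ : x ∉ J := fun hxJ => (Set.eq_empty_iff_forall_notMem.1 hdisj x)
        ⟨hxJ, Finset.mem_biUnion.2 ⟨j, Finset.mem_univ j, hx⟩⟩
      have := @hsub x
      simp [DBDelta, hxI, hxJ, hxI'] at this
    rw [Finset.union_subset_iff, Finset.biUnion_subset, Finset.biUnion_subset] at hPI'
    exact ⟨I', hI', fun i => (hS i).mem hI'.1 (hPI'.1 i (Finset.mem_univ i)),
      fun j => (hBN j).notMem hI'.1 (hPI'.2 j (Finset.mem_univ j)) (hNI' j)⟩
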